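/- Fix integers n ≥ k ≥ 2 and let σ be a permutation of {1,…,k}. Then the unitary Weingarten functions satisfy the recursion n·Wg_k(n, σ) + Σ_{i=2}^{k} Wg_k(n, (1 i)σ) = δ_{σ(1),1} · Wg_{k−1}(n, σ'), where (1 i) is the transposition exchanging 1 and i, δ_{σ(1),1} equals 1 if σ(1) = 1 and 0 otherwise, and, in the case σ(1) = 1, σ' is the permutation of {2,…,k} ≅ {1,…,k−1} obtained by restricting σ. -/

import Mathlib

/-- `cycleCount ρ`: the number of cycles of the permutation `ρ`, counting fixed points. -/
def cycleCount {k : ℕ} (ρ : Equiv.Perm (Fin k)) : ℕ :=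
  ρ.cycleType.card + (Finset.univ.filter fun a : Fin k => ρ a = a).card

/-- The Gram matrix `G_k(n)` indexed by `S_k`, with entries `n^{#(στ⁻¹)}`. -/
noncomputable def gramMatrix (k n : ℕ) :
    Matrix (Equiv.Perm (Fin k)) (Equiv.Perm (Fin k)) ℝ :=
  fun σ τ => (n : ℝ) ^ cycleCount (σ * τ⁻¹)

/-- The unitary Weingarten function `Wg_k(n,σ) = (G_k(n)⁻¹)_{σ,e}`. -/
noncomputable def Wg (k n : ℕ) (σ : Equiv.Perm (Fin k)) : ℝ :=
  (gramMatrix k n)⁻¹ σ 1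

section CycleCount

open Equiv Equiv.Perm Finset

/-- Composing a cycle `c` with the transposition that splits off a moved point `x`
turns one nontrivial cycle into a shorter one and a fixed point. -/
theorem Equiv.Perm.IsCycle.card_cycleType_swap_mul {α : Type*} [Fintype α] [DecidableEq α]
    {c : Perm α} (hc : c.IsCycle) {x : α} (hx : c x ≠ x) :
    (swap x (c x) * c).cycleType.card + c.support.card
      = c.cycleType.card + (swap x (c x) * c).support.card + 1 := by
  by_cases h : c (c x) = x
  · have hs := hc.eq_swap_of_apply_apply_eq_self hx h
    have h1 : swap x (c x) * c = 1 := by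
      conv_lhs => rw [hs]
      simp
    have h2 : c.support.card = 2 := by rw [hs]; exact card_support_swap hx.symm
    rw [h1, h2, hc.cycleType]
    simp
  · have hc' := hc.swap_mul hx h
    rw [hc.cycleType, hc'.cycleType, support_swap_mul_eq _ _ h, sdiff_singleton_eq_erase]
    have := card_erase_add_one (mem_support.2 hx)
    simp only [Multiset.card_singleton]
    omega

/-- Splitting a moved point `x` off an arbitrary permutation. -/
theorem Equiv.Perm.card_cycleType_swap_mul {α : Type*} [Fintype α] [DecidableEq α]
    (ρ : Perm α) {x : α} (hx : ρ x ≠ x) :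
    (swap x (ρ x) * ρ).cycleType.card + ρ.support.card
      = ρ.cycleType.card + (swap x (ρ x) * ρ).support.card + 1 := by
  have hmem : ρ.cycleOf x ∈ ρ.cycleFactorsFinset :=
    cycleOf_mem_cycleFactorsFinset_iff.2 (mem_support.2 hx)
  have hdis := disjoint_mul_inv_of_mem_cycleFactorsFinset hmem
  have hcyc := isCycle_cycleOf ρ hx
  have hcx : ρ.cycleOf x x = ρ x := cycleOf_apply_self ρ x
  generalize ρ.cycleOf x = c at *
  have hcd : c * (ρ * c⁻¹) = ρ := by rw [← hdis.commute.eq]; group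
  generalize ρ * c⁻¹ = d at *
  have hdis' : Disjoint (swap x (c x) * c) d := by
    intro y
    rcases hdis y with h | h
    · exact Or.inr h
    · left
      have h1 : y ≠ x := by
        rintro rfl
        rw [hcx] at h
        exact hx h
      have h2 : y ≠ c x := by
        rintro rfl
        exact h1 (c.injective h)
      rw [mul_apply, h, swap_apply_of_ne_of_ne h1 h2]
  have hne : c x ≠ x := by rwa [hcx]
  have key := hcyc.card_cycleType_swap_mul hne
  rw [← hcx]
  rw [← hcd, ← mul_assoc, hdis'.cycleType_mul, hdis.symm.cycleType_mul, hdis'.card_support_mul,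
    hdis.symm.card_support_mul]
  simp only [Multiset.card_add]
  omega

theorem cycleCount_add_card_support {k : ℕ} (ρ : Perm (Fin k)) :
    cycleCount ρ + ρ.support.card = ρ.cycleType.card + k := by
  have h := card_filter_add_card_filter_not (s := (univ : Finset (Fin k))) (fun a => ρ a = a)
  have hs : ρ.support = univ.filter fun a => ¬ ρ a = a := by
    ext; simp
  rw [card_univ, Fintype.card_fin] at h
  rw [cycleCount, hs]
  omega

theorem cycleCount_swap_mul {k : ℕ} (ρ : Perm (Fin k)) {x : Fin k} (hx : ρ x ≠ x) :
    cycleCount (swap x (ρ x) * ρ) = cycleCount ρ + 1 := by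
  have h1 := cycleCount_add_card_support ρ
  have h2 := cycleCount_add_card_support (swap x (ρ x) * ρ)
  have h3 := ρ.card_cycleType_swap_mul hx
  omega

/-- The permutation of `{0,…,k}` fixing `0` and acting as `τ` on the remaining points. -/
def liftPerm {k : ℕ} (τ : Perm (Fin k)) : Perm (Fin (k + 1)) :=
  decomposeFin.symm (0, τ)

@[simp]
theorem liftPerm_zero {k : ℕ} (τ : Perm (Fin k)) : liftPerm τ 0 = 0 := by
  simp [liftPerm]

@[simp]
theorem liftPerm_succ {k : ℕ} (τ : Perm (Fin k)) (i : Fin k) :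
    liftPerm τ i.succ = (τ i).succ := by
  simp [liftPerm]

theorem liftPerm_mul {k : ℕ} (σ τ : Perm (Fin k)) :
    liftPerm (σ * τ) = liftPerm σ * liftPerm τ := by
  ext i
  refine Fin.cases ?_ (fun j => ?_) i <;> simp

theorem liftPerm_one {k : ℕ} : liftPerm (1 : Perm (Fin k)) = 1 := by
  ext i
  refine Fin.cases ?_ (fun j => ?_) i <;> simp

theorem liftPerm_inv {k : ℕ} (τ : Perm (Fin k)) : liftPerm τ⁻¹ = (liftPerm τ)⁻¹ := by
  rw [eq_inv_iff_mul_eq_one, ← liftPerm_mul, inv_mul_cancel, liftPerm_one]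

theorem liftPerm_injective {k : ℕ} : Function.Injective (liftPerm (k := k)) := by
  intro σ τ h
  simpa [liftPerm] using h

theorem decomposeFin_symm_eq {k : ℕ} (p : Fin (k + 1)) (τ : Perm (Fin k)) :
    decomposeFin.symm (p, τ) = swap 0 p * liftPerm τ := by
  ext i
  refine Fin.cases ?_ (fun j => ?_) i <;> simp

theorem liftPerm_decomposeFin {k : ℕ} {σ : Perm (Fin (k + 1))} (h : σ 0 = 0) :
    liftPerm (decomposeFin σ).2 = σ := by
  have h1 : decomposeFin.symm ((decomposeFin σ).1, (decomposeFin σ).2) = σ := by simp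
  have h2 : (decomposeFin σ).1 = 0 := by
    rw [← h, ← decomposeFin_symm_apply_zero (decomposeFin σ).1 (decomposeFin σ).2, h1]
  rwa [h2] at h1

theorem cycleCount_liftPerm {k : ℕ} (τ : Perm (Fin k)) :
    cycleCount (liftPerm τ) = cycleCount τ + 1 := by
  have h : liftPerm τ = τ.extendDomain (finSuccAboveEquiv (0 : Fin (k + 1))) := by
    ext i
    refine Fin.cases ?_ (fun j => ?_) i
    · rw [extendDomain_apply_not_subtype _ _ (by simp)]
      simp
    · have := extendDomain_apply_image τ (finSuccAboveEquiv (0 : Fin (k + 1))) j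
      simp only [finSuccAboveEquiv_apply, Fin.succAbove_zero] at this
      simp [this]
  have h1 := cycleCount_add_card_support τ
  have h2 := cycleCount_add_card_support (liftPerm τ)
  rw [h, cycleType_extendDomain, card_support_extend_domain, ← h] at h2
  omega

theorem cycleCount_swap_mul_liftPerm {k : ℕ} {p : Fin (k + 1)} (hp : p ≠ 0) (τ : Perm (Fin k)) :
    cycleCount (swap 0 p * liftPerm τ) = cycleCount τ := by
  have h0 : (swap 0 p * liftPerm τ) 0 = p := by simp
  have h := cycleCount_swap_mul (swap 0 p * liftPerm τ) (x := 0) (by rwa [h0])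
  rw [h0, ← mul_assoc, swap_mul_self, one_mul, cycleCount_liftPerm] at h
  omega

end CycleCount

section Gram

open Equiv Equiv.Perm Finset Matrix

/-- The action of `n + Σ_{i ≠ 0} (0 i)` on functions on the symmetric group. -/
noncomputable def jucysMurphy {k : ℕ} (n : ℕ) (f : Perm (Fin (k + 1)) → ℝ) :
    Perm (Fin (k + 1)) → ℝ :=
  fun σ => (n : ℝ) * f σ + ∑ i ∈ univ.filter fun i : Fin (k + 1) => i ≠ 0, f (swap 0 i * σ)

/-- Convolution over the stabilizer of `0` with `τ ↦ n ^ cycleCount τ`. -/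
noncomputable def stabConv {k : ℕ} (n : ℕ) (f : Perm (Fin (k + 1)) → ℝ) :
    Perm (Fin (k + 1)) → ℝ :=
  fun σ => ∑ τ : Perm (Fin k), (n : ℝ) ^ cycleCount τ * f ((liftPerm τ)⁻¹ * σ)

theorem gramMatrix_mulVec_apply (k n : ℕ) (f : Perm (Fin k) → ℝ) (σ : Perm (Fin k)) :
    (gramMatrix k n *ᵥ f) σ = ∑ τ, (n : ℝ) ^ cycleCount τ * f (τ⁻¹ * σ) := by
  simp only [mulVec, dotProduct, gramMatrix]
  refine Fintype.sum_equiv ((Equiv.inv _).trans (Equiv.mulLeft σ)) _ _ fun τ => ?_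
  simp

theorem jucysMurphy_eq_sum {k : ℕ} (n : ℕ) (f : Perm (Fin (k + 1)) → ℝ)
    (σ : Perm (Fin (k + 1))) :
    jucysMurphy n f σ = ∑ i, (if i = 0 then (n : ℝ) else 1) * f (swap 0 i * σ) := by
  rw [jucysMurphy, filter_ne', ← add_sum_erase _ _ (mem_univ (0 : Fin (k + 1)))]
  congr 1
  · rw [if_pos rfl, swap_self, ← Perm.one_def, one_mul]
  · refine sum_congr rfl fun i hi => ?_
    simp [ne_of_mem_erase hi]

theorem gramMatrix_succ_mulVec (k n : ℕ) (f : Perm (Fin (k + 1)) → ℝ) :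
    gramMatrix (k + 1) n *ᵥ f = jucysMurphy n (stabConv n f) := by
  ext σ
  rw [gramMatrix_mulVec_apply, jucysMurphy_eq_sum, ← decomposeFin.symm.sum_comp,
    Fintype.sum_prod_type]
  refine sum_congr rfl fun p _ => ?_
  rw [stabConv, mul_sum]
  refine sum_congr rfl fun τ _ => ?_
  rw [decomposeFin_symm_eq, _root_.mul_inv_rev, swap_inv, mul_assoc]
  by_cases hp : p = 0
  · subst hp
    rw [swap_self, ← Perm.one_def, one_mul, cycleCount_liftPerm, if_pos rfl]
    ring
  · rw [cycleCount_swap_mul_liftPerm hp, if_neg hp, one_mul]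

theorem jucysMurphy_stabConv_comm {k : ℕ} (n : ℕ) (f : Perm (Fin (k + 1)) → ℝ) :
    jucysMurphy n (stabConv n f) = stabConv n (jucysMurphy n f) := by
  ext σ
  simp only [jucysMurphy_eq_sum, stabConv, mul_sum]
  rw [sum_comm]
  refine sum_congr rfl fun τ _ => ?_
  rw [← Equiv.sum_comp (liftPerm τ)]
  refine sum_congr rfl fun p _ => ?_
  have h0 : liftPerm τ p = 0 ↔ p = 0 := by
    rw [← (liftPerm τ).injective.eq_iff (a := p), liftPerm_zero]
  have hs : (liftPerm τ)⁻¹ * (swap 0 (liftPerm τ p) * σ)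
      = swap 0 p * ((liftPerm τ)⁻¹ * σ) := by
    have := mul_swap_eq_swap_mul (liftPerm τ) 0 p
    rw [liftPerm_zero] at this
    rw [inv_mul_eq_iff_eq_mul, ← mul_assoc, ← mul_assoc, this, mul_inv_cancel_right]
  simp only [h0, hs]
  ring

theorem jucysMurphy_eq_zero {k n : ℕ} (hn : k + 1 ≤ n) {f : Perm (Fin (k + 1)) → ℝ}
    (h : jucysMurphy n f = 0) : f = 0 := by
  obtain ⟨σ, hσ⟩ := Finite.exists_max fun σ => |f σ|
  have h1 : (n : ℝ) * |f σ| ≤ k * |f σ| := by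
    have h2 : (n : ℝ) * f σ
        = -∑ i ∈ univ.filter fun i : Fin (k + 1) => i ≠ 0, f (swap 0 i * σ) :=
      eq_neg_of_add_eq_zero_left (congrFun h σ)
    calc (n : ℝ) * |f σ| = |(n : ℝ) * f σ| := by rw [abs_mul, Nat.abs_cast]
      _ ≤ ∑ i ∈ univ.filter fun i : Fin (k + 1) => i ≠ 0, |f (swap 0 i * σ)| := by
          rw [h2, abs_neg]
          exact abs_sum_le_sum_abs _ _
      _ ≤ ∑ i ∈ univ.filter fun i : Fin (k + 1) => i ≠ 0, |f σ| :=
          sum_le_sum fun i _ => hσ _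
      _ = k * |f σ| := by simp [filter_ne', card_erase_of_mem]
  have h3 : (k : ℝ) + 1 ≤ n := by exact_mod_cast hn
  have h4 : |f σ| ≤ 0 := by nlinarith [abs_nonneg (f σ)]
  ext τ
  exact abs_nonpos_iff.1 ((hσ τ).trans h4)

theorem stabConv_liftPerm_mul {k : ℕ} (n : ℕ) (f : Perm (Fin (k + 1)) → ℝ) (σ : Perm (Fin k))
    (ρ : Perm (Fin (k + 1))) :
    stabConv n f (liftPerm σ * ρ) = (gramMatrix k n *ᵥ fun τ => f (liftPerm τ * ρ)) σ := by
  simp only [gramMatrix_mulVec_apply, stabConv, liftPerm_mul, liftPerm_inv, mul_assoc]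

theorem stabConv_eq_zero {k n : ℕ} (hG : IsUnit (gramMatrix k n))
    {f : Perm (Fin (k + 1)) → ℝ} (h : stabConv n f = 0) : f = 0 := by
  ext ρ
  have h1 : (gramMatrix k n *ᵥ fun τ => f (liftPerm τ * ρ)) = gramMatrix k n *ᵥ 0 := by
    ext σ
    rw [← stabConv_liftPerm_mul, h, mulVec_zero]
    rfl
  have h2 := congrFun (mulVec_injective_iff_isUnit.2 hG h1) 1
  simpa [liftPerm_one] using h2

theorem stabConv_sub {k : ℕ} (n : ℕ) (f g : Perm (Fin (k + 1)) → ℝ) :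
    stabConv n (f - g) = stabConv n f - stabConv n g := by
  ext σ
  simp [stabConv, mul_sub, sum_sub_distrib]

theorem isUnit_gramMatrix {k n : ℕ} (hn : k ≤ n) : IsUnit (gramMatrix k n) := by
  induction k with
  | zero =>
    have h : gramMatrix 0 n = 1 := by
      ext σ τ
      rw [Subsingleton.elim σ τ]
      simp [gramMatrix, cycleCount]
    rw [h]
    exact isUnit_one
  | succ k ih =>
    rw [← mulVec_injective_iff_isUnit]
    refine (injective_iff_map_eq_zero (gramMatrix (k + 1) n).mulVecLin).2 fun f hf => ?_
    rw [mulVecLin_apply, gramMatrix_succ_mulVec] at hf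
    exact stabConv_eq_zero (ih (by omega)) (jucysMurphy_eq_zero hn hf)

theorem gramMatrix_mulVec_Wg {k n : ℕ} (hn : k ≤ n) :
    gramMatrix k n *ᵥ Wg k n = Pi.single 1 1 := by
  have h := mul_nonsing_inv _ ((isUnit_iff_isUnit_det _).1 (isUnit_gramMatrix hn))
  ext σ
  have h' := congrFun (congrFun h σ) 1
  rw [Matrix.mul_apply, Matrix.one_apply] at h'
  rw [Pi.single_apply, ← h']
  rfl

/-- Extension by zero of `Wg k n` from the stabilizer of `0`. -/
noncomputable def extendWg (k n : ℕ) (σ : Perm (Fin (k + 1))) : ℝ :=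
  if σ 0 = 0 then Wg k n (decomposeFin σ).2 else 0

theorem extendWg_liftPerm (k n : ℕ) (τ : Perm (Fin k)) : extendWg k n (liftPerm τ) = Wg k n τ := by
  rw [extendWg, if_pos (liftPerm_zero τ), liftPerm, Equiv.apply_symm_apply]

theorem stabConv_extendWg {k n : ℕ} (hn : k ≤ n) :
    stabConv n (extendWg k n) = Pi.single 1 1 := by
  ext σ
  by_cases h : σ 0 = 0
  · obtain ⟨τ, rfl⟩ : ∃ τ, liftPerm τ = σ := ⟨_, liftPerm_decomposeFin h⟩
    rw [← mul_one (liftPerm τ), stabConv_liftPerm_mul]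
    simp only [mul_one, extendWg_liftPerm]
    have := congrFun (gramMatrix_mulVec_Wg hn) τ
    rw [this, Pi.single_apply, Pi.single_apply]
    simp only [← liftPerm_one, liftPerm_injective.eq_iff]
  · rw [Pi.single_apply, if_neg (by rintro rfl; simp at h), stabConv]
    refine sum_eq_zero fun τ _ => ?_
    rw [extendWg, if_neg, mul_zero]
    rw [Perm.mul_apply, inv_eq_iff_eq, liftPerm_zero]
    exact h

theorem jucysMurphy_Wg {k n : ℕ} (hn : k + 1 ≤ n) :
    jucysMurphy n (Wg (k + 1) n) = extendWg k n := by
  rw [← sub_eq_zero]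
  refine stabConv_eq_zero (n := n) (isUnit_gramMatrix (by omega)) ?_
  rw [stabConv_sub, ← jucysMurphy_stabConv_comm, ← gramMatrix_succ_mulVec,
    gramMatrix_mulVec_Wg hn, stabConv_extendWg (by omega), sub_self]

end Gram

/-- Weingarten's recursion: for `σ ∈ S_{k+1}` (on points `{0,1,…,k}`, the point `0`
playing the role of `1` in `{1,…,k+1}`),
`n·Wg_{k+1}(n,σ) + Σ_{i≠0} Wg_{k+1}(n,(0 i)σ) = δ_{σ(0),0}·Wg_k(n,σ')`,
where `σ'` is the restriction of `σ` to the remaining `k` points when `σ 0 = 0`. -/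
theorem stmt11 (k n : ℕ) (hk : 1 ≤ k) (hn : k + 1 ≤ n) (σ : Equiv.Perm (Fin (k + 1))) :
    (σ 0 = 0 →
      ∀ σ' : Equiv.Perm (Fin k), (∀ i : Fin k, σ i.succ = (σ' i).succ) →
        (n : ℝ) * Wg (k + 1) n σ +
          ∑ i ∈ Finset.univ.filter fun i : Fin (k + 1) => i ≠ 0,
            Wg (k + 1) n (Equiv.swap 0 i * σ)
          = Wg k n σ') ∧
    (σ 0 ≠ 0 →
      (n : ℝ) * Wg (k + 1) n σ +
        ∑ i ∈ Finset.univ.filter fun i : Fin (k + 1) => i ≠ 0,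
          Wg (k + 1) n (Equiv.swap 0 i * σ)
        = 0) := by
  have h := congrFun (jucysMurphy_Wg hn) σ
  rw [jucysMurphy] at h
  rw [h]
  refine ⟨fun _ σ' hσ' => ?_, fun h0 => if_neg h0⟩
  have hσ : σ = liftPerm σ' := by
    ext i
    refine Fin.cases ?_ (fun j => ?_) i <;> simp [*]
  rw [hσ, extendWg_liftPerm]
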